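/- Let F be a finite field with q elements, q ≥ 5, and let K be a complete generalized k-arc in P²(F) which is also a k-arc (no 3 of its points are collinear). Then C(k,5)·(q−4) + k ≥ q² + q + 1, where C(n,r) denotes the binomial coefficient. -/

import Mathlib

/-- The projective plane over `F`: points are 1-dimensional subspaces of `F³`. -/
abbrev P2 (F : Type*) [Field F] := Projectivization F (Fin 3 → F)

/-- A conic in `P²(F)`: the vanishing set of a nonzero homogeneous quadratic form
in three variables (possibly reducible). -/
def IsConic {F : Type*} [Field F] (C : Set (P2 F)) : Prop :=
  ∃ Q : MvPolynomial (Fin 3) F, Q ≠ 0 ∧ Q.IsHomogeneous 2 ∧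
    C = {p : P2 F | MvPolynomial.eval p.rep Q = 0}

/-- A line in `P²(F)`: the vanishing set of a nonzero linear form in three variables. -/
def IsLine {F : Type*} [Field F] (L : Set (P2 F)) : Prop :=
  ∃ φ : MvPolynomial (Fin 3) F, φ ≠ 0 ∧ φ.IsHomogeneous 1 ∧
    L = {p : P2 F | MvPolynomial.eval p.rep φ = 0}

/-- A generalized arc: no conic contains 6 of its points. -/
def IsGenArc {F : Type*} [Field F] (K : Set (P2 F)) : Prop :=
  ∀ C : Set (P2 F), IsConic C → (K ∩ C).ncard ≤ 5

/-- An arc: no line contains 3 of its points. -/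
def IsArc {F : Type*} [Field F] (K : Set (P2 F)) : Prop :=
  ∀ L : Set (P2 F), IsLine L → (K ∩ L).ncard ≤ 2

open MvPolynomial

/-- A homogeneous quadratic polynomial is the diagonal of a bilinear form. -/
theorem MvPolynomial.IsHomogeneous.exists_bilin {σ R : Type*} [CommSemiring R]
    {Q : MvPolynomial σ R} (hQ : Q.IsHomogeneous 2) :
    ∃ B : (σ → R) →ₗ[R] (σ → R) →ₗ[R] R, ∀ x, eval x Q = B x x := by
  have hmem : Q ∈ Submodule.span R (Set.range X) ^ 2 := by
    rw [← homogeneousSubmodule_one_eq_span_X, homogeneousSubmodule_one_pow]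
    exact hQ
  rw [pow_two, Submodule.span_mul_span] at hmem
  clear hQ
  induction hmem using Submodule.span_induction with
  | mem P hP =>
    obtain ⟨_, ⟨i, rfl⟩, _, ⟨j, rfl⟩, rfl⟩ := hP
    exact ⟨(LinearMap.mul R R).compl₁₂ (LinearMap.proj i) (LinearMap.proj j), fun x => by simp⟩
  | zero => exact ⟨0, fun x => by simp⟩
  | add P P' _ _ h h' =>
    obtain ⟨B, hB⟩ := h
    obtain ⟨B', hB'⟩ := h'
    exact ⟨B + B', fun x => by simp [hB, hB']⟩
  | smul c P _ h =>
    obtain ⟨B, hB⟩ := h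
    exact ⟨c • B, fun x => by simp [hB, smul_eval]⟩

section Vectors

variable {F V : Type*} [Field F] [AddCommGroup V] [Module F V]

/-- No nonzero linear form vanishes at all three vectors. -/
def Noncollinear (F : Type*) {V : Type*} [Field F] [AddCommGroup V] [Module F V]
    (u v w : V) : Prop :=
  ∀ l : V →ₗ[F] F, l u = 0 → l v = 0 → l w = 0 → l = 0

theorem Noncollinear.exists_basis (hV : Module.finrank F V = 3) {u v w : V}
    (h : Noncollinear F u v w) : ∃ b : Module.Basis (Fin 3) F V, b 0 = u ∧ b 1 = v ∧ b 2 = w := by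
  have hspan : ⊤ ≤ Submodule.span F (Set.range ![u, v, w]) := by
    by_contra hlt
    obtain ⟨l, hl, hle⟩ := Submodule.exists_le_ker_of_lt_top _
      (lt_top_iff_ne_top.2 fun he => hlt he.ge)
    have hz (i : Fin 3) : l (![u, v, w] i) = 0 :=
      hle (Submodule.subset_span (Set.mem_range_self i))
    exact hl (h l (hz 0) (hz 1) (hz 2))
  refine ⟨basisOfTopLeSpanOfCardEqFinrank _ hspan (by simp [hV]), ?_⟩
  simp

theorem Module.Basis.bilin_self_eq (b : Module.Basis (Fin 3) F V) {B : V →ₗ[F] V →ₗ[F] F}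
    (h : ∀ i, B (b i) (b i) = 0) (x : V) :
    B x x = (B (b 1) (b 2) + B (b 2) (b 1)) * (b.coord 1 x * b.coord 2 x)
      + b.coord 0 x * ((B (b 0) (b 2) + B (b 2) (b 0)) * b.coord 2 x
        + (B (b 0) (b 1) + B (b 1) (b 0)) * b.coord 1 x) := by
  have hx : x = b.coord 0 x • b 0 + b.coord 1 x • b 1 + b.coord 2 x • b 2 := by
    conv_lhs => rw [← b.sum_repr x, Fin.sum_univ_three]
    rfl
  generalize b.coord 0 x = c₀ at *
  generalize b.coord 1 x = c₁ at *
  generalize b.coord 2 x = c₂ at *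
  subst hx
  simp only [map_add, map_smul, LinearMap.add_apply, LinearMap.smul_apply, smul_eq_mul, h]
  ring

/-- A quadratic form vanishing at five points in general position, two of which are moreover
conjugate, vanishes identically. -/
theorem Noncollinear.bilin_self_eq_zero (hV : Module.finrank F V = 3) {u v w s t : V}
    (huvw : Noncollinear F u v w) (hvws : Noncollinear F v w s) (hvwt : Noncollinear F v w t)
    (hust : Noncollinear F u s t) {B : V →ₗ[F] V →ₗ[F] F} (hu : B u u = 0) (hv : B v v = 0)
    (hw : B w w = 0) (hs : B s s = 0) (ht : B t t = 0) (h : B v w + B w v = 0) (x : V) :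
    B x x = 0 := by
  obtain ⟨b, rfl, rfl, rfl⟩ := huvw.exists_basis hV
  have hb : ∀ i, B (b i) (b i) = 0 := by
    intro i
    fin_cases i <;> assumption
  have key := b.bilin_self_eq hb
  simp only [h, zero_mul, zero_add] at key
  have hc : b.coord 0 ≠ 0 := fun h0 => by simpa using LinearMap.congr_fun h0 (b 0)
  have hs0 : b.coord 0 s ≠ 0 := fun h0 => hc (hvws _ (by simp) (by simp) h0)
  have ht0 : b.coord 0 t ≠ 0 := fun h0 => hc (hvwt _ (by simp) (by simp) h0)
  have hs1 := (mul_eq_zero.1 ((key s).symm.trans hs)).resolve_left hs0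
  have ht1 := (mul_eq_zero.1 ((key t).symm.trans ht)).resolve_left ht0
  have hl := hust ((B (b 0) (b 2) + B (b 2) (b 0)) • b.coord 2
    + (B (b 0) (b 1) + B (b 1) (b 0)) • b.coord 1) (by simp) (by simpa using hs1)
    (by simpa using ht1)
  have hlx := LinearMap.congr_fun hl x
  simp only [LinearMap.add_apply, LinearMap.smul_apply, smul_eq_mul, LinearMap.zero_apply] at hlx
  rw [key, hlx, mul_zero]

/-- A family of vectors of which no three are collinear. -/
def GeneralPosition (F : Type*) {V ι : Type*} [Field F] [AddCommGroup V] [Module F V]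
    (e : ι → V) : Prop :=
  ∀ i j k, i ≠ j → i ≠ k → j ≠ k → Noncollinear F (e i) (e j) (e k)

variable {e : Fin 5 → V}

/-- Two quadratic forms vanishing at the same five points in general position, the first being
nonzero, have nested zero sets. -/
theorem GeneralPosition.bilin_self_eq_zero_of (hV : Module.finrank F V = 3)
    (he : GeneralPosition F e) {B B' : V →ₗ[F] V →ₗ[F] F} (hB : ∀ i, B (e i) (e i) = 0)
    (hB' : ∀ i, B' (e i) (e i) = 0) (hne : ¬ ∀ x, B x x = 0) {x : V} (hx : B x x = 0) :
    B' x x = 0 := by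
  have ha : B (e 1) (e 2) + B (e 2) (e 1) ≠ 0 := fun h =>
    hne ((he 0 1 2 (by decide) (by decide) (by decide)).bilin_self_eq_zero hV
      (he 1 2 3 (by decide) (by decide) (by decide)) (he 1 2 4 (by decide) (by decide) (by decide))
      (he 0 3 4 (by decide) (by decide) (by decide)) (hB 0) (hB 1) (hB 2) (hB 3) (hB 4) h)
  have h0 : ∀ i, ((B (e 1) (e 2) + B (e 2) (e 1)) • B'
      - (B' (e 1) (e 2) + B' (e 2) (e 1)) • B) (e i) (e i) = 0 := by
    simp [hB, hB']
  have h := (he 0 1 2 (by decide) (by decide) (by decide)).bilin_self_eq_zero hV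
      (he 1 2 3 (by decide) (by decide) (by decide)) (he 1 2 4 (by decide) (by decide) (by decide))
      (he 0 3 4 (by decide) (by decide) (by decide)) (h0 0) (h0 1) (h0 2) (h0 3) (h0 4)
      (by simp; ring) x
  simpa [hx, ha] using h

/-- The zeros of a quadratic form through five points in general position embed into a plane. -/
theorem GeneralPosition.exists_injOn (hV : Module.finrank F V = 3)
    (he : GeneralPosition F e) {B : V →ₗ[F] V →ₗ[F] F} (hB : ∀ i, B (e i) (e i) = 0)
    (hne : ¬ ∀ x, B x x = 0) :
    ∃ g : V → F × F, Set.InjOn g {x | B x x = 0} := by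
  classical
  have ha : B (e 1) (e 2) + B (e 2) (e 1) ≠ 0 := fun h =>
    hne ((he 0 1 2 (by decide) (by decide) (by decide)).bilin_self_eq_zero hV
      (he 1 2 3 (by decide) (by decide) (by decide)) (he 1 2 4 (by decide) (by decide) (by decide))
      (he 0 3 4 (by decide) (by decide) (by decide)) (hB 0) (hB 1) (hB 2) (hB 3) (hB 4) h)
  have hb : B (e 0) (e 2) + B (e 2) (e 0) ≠ 0 := fun h =>
    hne ((he 1 0 2 (by decide) (by decide) (by decide)).bilin_self_eq_zero hV
      (he 0 2 3 (by decide) (by decide) (by decide)) (he 0 2 4 (by decide) (by decide) (by decide))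
      (he 1 3 4 (by decide) (by decide) (by decide)) (hB 1) (hB 0) (hB 2) (hB 3) (hB 4) h)
  have hc : B (e 0) (e 1) + B (e 1) (e 0) ≠ 0 := fun h =>
    hne ((he 2 0 1 (by decide) (by decide) (by decide)).bilin_self_eq_zero hV
      (he 0 1 3 (by decide) (by decide) (by decide)) (he 0 1 4 (by decide) (by decide) (by decide))
      (he 2 3 4 (by decide) (by decide) (by decide)) (hB 2) (hB 0) (hB 1) (hB 3) (hB 4) h)
  obtain ⟨β, h0, h1, h2⟩ := (he 0 1 2 (by decide) (by decide) (by decide)).exists_basis hV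
  have hβ : ∀ i, B (β i) (β i) = 0 := by
    intro i
    fin_cases i
    · simpa [h0] using hB 0
    · simpa [h1] using hB 1
    · simpa [h2] using hB 2
  have key := β.bilin_self_eq hβ
  rw [h0, h1, h2] at key
  generalize B (e 1) (e 2) + B (e 2) (e 1) = a at *
  generalize B (e 0) (e 2) + B (e 2) (e 0) = b at *
  generalize B (e 0) (e 1) + B (e 1) (e 0) = c at *
  have hpole : ∀ x, B x x = 0 → b * β.coord 2 x + c * β.coord 1 x = 0 →
      β.coord 1 x = 0 ∧ β.coord 2 x = 0 := by
    intro x hx hl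
    rw [key, hl, mul_zero, add_zero] at hx
    rcases mul_eq_zero.1 ((mul_eq_zero.1 hx).resolve_left ha) with h | h
    · simpa [h, hb] using hl
    · simpa [h, hc] using hl
  have hext : ∀ x y, β.coord 0 x = β.coord 0 y → β.coord 1 x = β.coord 1 y →
      β.coord 2 x = β.coord 2 y → x = y := by
    intro x y h0 h1 h2
    refine β.ext_elem fun i => ?_
    fin_cases i <;> assumption
  refine ⟨fun x => if β.coord 1 x = 0 ∧ β.coord 2 x = 0 then
    (β.coord 0 x * b, -(β.coord 0 x * c)) else (β.coord 1 x, β.coord 2 x), ?_⟩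
  intro x hx y hy hxy
  have hx : B x x = 0 := hx
  have hy : B y y = 0 := hy
  dsimp only at hxy
  split_ifs at hxy with h h' h'
  · rw [Prod.mk.injEq] at hxy
    exact hext _ _ (mul_right_cancel₀ hb hxy.1) (h.1.trans h'.1.symm) (h.2.trans h'.2.symm)
  · rw [Prod.mk.injEq] at hxy
    exact absurd (hpole y hy (by rw [← hxy.1, ← hxy.2]; ring)) h'
  · rw [Prod.mk.injEq] at hxy
    exact absurd (hpole x hx (by rw [hxy.1, hxy.2]; ring)) h
  · rw [Prod.mk.injEq] at hxy
    refine hext _ _ ?_ hxy.1 hxy.2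
    have hl : b * β.coord 2 x + c * β.coord 1 x ≠ 0 := fun hl => h (hpole x hx hl)
    have hx' := key x
    have hy' := key y
    rw [hx, hxy.1, hxy.2] at hx'
    rw [hxy.1, hxy.2] at hl
    rw [hy] at hy'
    exact mul_right_cancel₀ hl (by linear_combination hy' - hx')

/-- A conic through five points in general position has at most `q + 1` points. -/
theorem GeneralPosition.ncard_conic_le [Fintype F] (hV : Module.finrank F V = 3)
    (he : GeneralPosition F e) {B : V →ₗ[F] V →ₗ[F] F} (hB : ∀ i, B (e i) (e i) = 0)
    (hne : ¬ ∀ x, B x x = 0) :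
    {p : Projectivization F V | B p.rep p.rep = 0}.ncard ≤ Fintype.card F + 1 := by
  classical
  obtain ⟨g, hg⟩ := he.exists_injOn hV hB hne
  set C : Set (Projectivization F V) := {p | B p.rep p.rep = 0} with hC
  let v : Option (C × Fˣ) → V := fun o => o.elim 0 fun p => p.2 • p.1.1.rep
  have hv : Function.Injective v := by
    have hnz : ∀ p : C × Fˣ, p.2 • p.1.1.rep ≠ 0 := fun p h =>
      p.1.1.rep_nonzero ((smul_eq_zero_iff_eq _).1 h)
    rintro (_ | ⟨p, a⟩) (_ | ⟨p', a'⟩) h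
    · rfl
    · exact absurd h.symm (hnz _)
    · exact absurd h (hnz _)
    · have h : a • p.1.rep = a' • p'.1.rep := h
      have hp : p = p' := by
        apply Subtype.ext
        rw [← p.1.mk_rep, ← p'.1.mk_rep, Projectivization.mk_eq_mk_iff]
        exact ⟨a⁻¹ * a', by rw [mul_smul, ← h, inv_smul_smul]⟩
      subst hp
      have ha : a = a' := by
        ext
        exact smul_left_injective F p.1.rep_nonzero h
      rw [ha]
  have hv0 : ∀ o, B (v o) (v o) = 0 := by
    rintro (_ | ⟨p, a⟩)
    · simp [v]
    · have := p.2
      simp only [hC, Set.mem_ofPred_eq] at this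
      simp [v, Units.smul_def, this]
  have hinj : Function.Injective (g ∘ v) := fun o o' h => hv (hg (hv0 o) (hv0 o') h)
  have hfin : Finite (C × Fˣ) :=
    Finite.of_injective (fun p => g (v (some p))) fun p p' h => Option.some_injective _ (hinj h)
  have hle := Nat.card_le_card_of_injective _ hinj
  rw [Finite.card_option, Nat.card_prod, Nat.card_prod, Nat.card_units, Nat.card_coe_set_eq,
    Nat.card_eq_fintype_card] at hle
  have h1 : 1 < Fintype.card F := Fintype.one_lt_card
  obtain ⟨n, hn⟩ := Nat.exists_eq_add_of_lt h1
  rw [hn] at hle ⊢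
  have : C.ncard * (n + 1) ≤ (n + 3) * (n + 1) := by
    have : 1 + n + 1 - 1 = n + 1 := by omega
    rw [this] at hle
    nlinarith
  have := Nat.le_of_mul_le_mul_right this (by omega)
  omega

end Vectors

section Plane

variable {F : Type*} [Field F]

theorem IsArc.noncollinear [Finite F] {K : Set (P2 F)} (hK : IsArc K) {p r s : P2 F} (hp : p ∈ K)
    (hr : r ∈ K) (hs : s ∈ K) (hpr : p ≠ r) (hps : p ≠ s) (hrs : r ≠ s) :
    Noncollinear F p.rep r.rep s.rep := by
  intro l hlp hlr hls
  by_contra hl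
  let φ : MvPolynomial (Fin 3) F := ∑ i, C (l (Pi.single i 1)) * X i
  have hφ : ∀ x, eval x φ = l x := by
    intro x
    conv_rhs => rw [pi_eq_sum_univ' x]
    simp [φ, mul_comm]
  have h := hK _ ⟨φ, fun h0 => hl (LinearMap.ext fun x => by rw [← hφ, h0]; simp),
    IsHomogeneous.sum _ _ _ fun i _ => isHomogeneous_C_mul_X _ _, rfl⟩
  have hsub : ({p, r, s} : Set (P2 F)) ⊆ K ∩ {x : P2 F | eval x.rep φ = 0} := by
    rintro x (rfl | rfl | rfl) <;> simp_all
  have := (Set.ncard_le_ncard hsub (Set.toFinite _)).trans h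
  rw [Set.ncard_eq_three.2 ⟨p, r, s, hpr, hps, hrs, rfl⟩] at this
  omega

/-- The points off `K` lying on some conic through `S`. -/
def conicPoints (K : Set (P2 F)) (S : Finset (P2 F)) : Set (P2 F) :=
  {p | p ∉ K ∧ ∃ Q : MvPolynomial (Fin 3) F, Q ≠ 0 ∧ Q.IsHomogeneous 2 ∧ eval p.rep Q = 0 ∧
    ∀ s ∈ S, eval s.rep Q = 0}

theorem IsArc.ncard_conicPoints_le [Fintype F] (hF : 2 ≤ Fintype.card F) {K : Set (P2 F)}
    (hK : IsArc K) {S : Finset (P2 F)} (hSK : (S : Set (P2 F)) ⊆ K) (hS : S.card = 5) :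
    (conicPoints K S).ncard ≤ Fintype.card F - 4 := by
  rcases (conicPoints K S).eq_empty_or_nonempty with h | ⟨p, -, Q, hQ0, hQ2, -, hQS⟩
  · simp [h]
  have hV : Module.finrank F (Fin 3 → F) = 3 := by simp
  let f := S.equivFinOfCardEq hS
  let e : Fin 5 → Fin 3 → F := fun i => (f.symm i : P2 F).rep
  have hne : ∀ i j, i ≠ j → (f.symm i : P2 F) ≠ f.symm j := fun i j hij h =>
    hij (f.symm.injective (Subtype.ext h))
  have he : GeneralPosition F e := fun i j k hij hik hjk =>
    hK.noncollinear (hSK (f.symm i).2) (hSK (f.symm j).2) (hSK (f.symm k).2)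
      (hne _ _ hij) (hne _ _ hik) (hne _ _ hjk)
  have hvanish : ∀ P : MvPolynomial (Fin 3) F, P ≠ 0 → P.IsHomogeneous 2 →
      ¬ ∀ x, eval x P = 0 := fun P hP0 hP2 h =>
    hP0 (hP2.eq_zero_of_forall_eval_eq_zero_of_le_card h (by
      rw [Cardinal.mk_fintype]; exact_mod_cast hF))
  obtain ⟨B, hB⟩ := hQ2.exists_bilin
  have hBe : ∀ i, B (e i) (e i) = 0 := fun i => by rw [← hB]; exact hQS _ (f.symm i).2
  have hBne : ¬ ∀ x, B x x = 0 := by simpa only [hB] using hvanish Q hQ0 hQ2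
  have hle : {p : P2 F | B p.rep p.rep = 0}.ncard ≤ _ := he.ncard_conic_le hV hBe hBne
  have hsub : conicPoints K S ∪ S ⊆ {p : P2 F | B p.rep p.rep = 0} := by
    rintro x (⟨-, P, hP0, hP2, hPx, hPS⟩ | hx)
    · obtain ⟨B', hB'⟩ := hP2.exists_bilin
      refine he.bilin_self_eq_zero_of hV (B := B')
        (fun i => by rw [← hB']; exact hPS _ (f.symm i).2) hBe ?_ (by rw [← hB', hPx])
      simpa only [hB'] using hvanish P hP0 hP2
    · exact (hB _).symm.trans (hQS x hx)
  have hdisj : Disjoint (conicPoints K S) S :=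
    Set.disjoint_left.2 fun x hx hxS => hx.1 (hSK hxS)
  have hcard := Set.ncard_le_ncard hsub (Set.toFinite _)
  rw [Set.ncard_union_eq hdisj (Set.toFinite _) (Set.toFinite _), Set.ncard_coe_finset, hS] at hcard
  omega

end Plane

/-- every complete generalized `k`-arc in `P²(F)` (`q ≥ 5`) which is also a
`k`-arc satisfies `C(k,5)(q−4) + k ≥ q² + q + 1`. -/
theorem stmt16 {F : Type*} [Field F] [Fintype F] (q : ℕ) (hq : Fintype.card F = q)
    (h5 : 5 ≤ q) (k : ℕ) (K : Set (P2 F)) (hgen : IsGenArc K) (hcard : K.ncard = k)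
    (hcomp : ∀ p ∉ K, ¬ IsGenArc (insert p K)) (harc : IsArc K) :
    q ^ 2 + q + 1 ≤ Nat.choose k 5 * (q - 4) + k := by
  classical
  subst hq hcard
  set T := K.toFinite.toFinset with hT
  have hTK : (T : Set (P2 F)) = K := by simp [hT]
  have hcover : Kᶜ.ncard ≤ (T.card.choose 5) * (Fintype.card F - 4) := by
    have hsub : Kᶜ.toFinite.toFinset ⊆
        (T.powersetCard 5).biUnion fun S => (conicPoints K S).toFinite.toFinset := by
      intro p hp
      have hp : p ∉ K := by simpa using hp
      have hn := hcomp p hp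
      simp only [IsGenArc, not_forall, not_le] at hn
      obtain ⟨C, ⟨Q, hQ0, hQ2, rfl⟩, hlt⟩ := hn
      have hK5 := hgen _ ⟨Q, hQ0, hQ2, rfl⟩
      set C := {p : P2 F | eval p.rep Q = 0} with hC
      have hpC : p ∈ C := by
        by_contra hpC
        rw [Set.insert_inter_of_notMem hpC] at hlt
        omega
      rw [Set.insert_inter_of_mem hpC] at hlt
      have h5 : 5 ≤ (K ∩ C).ncard := by
        have := Set.ncard_insert_le p (K ∩ C)
        omega
      rw [Set.ncard_eq_toFinset_card _ (Set.toFinite _)] at h5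
      obtain ⟨S, hS, hS5⟩ := Finset.exists_subset_card_eq h5
      have hS' : ∀ s ∈ S, s ∈ K ∩ C := fun s hs => by simpa using hS hs
      simp only [Finset.mem_biUnion, Finset.mem_powersetCard, Set.Finite.mem_toFinset]
      refine ⟨S, ⟨fun s hs => by simpa [hT] using (hS' s hs).1, hS5⟩, hp, Q, hQ0, hQ2, hpC,
        fun s hs => (hS' s hs).2⟩
    rw [Set.ncard_eq_toFinset_card _ (Set.toFinite _), ← Finset.card_powersetCard]
    refine (Finset.card_le_card hsub).trans (Finset.card_biUnion_le_card_mul _ _ _ fun S hS => ?_)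
    rw [Finset.mem_powersetCard] at hS
    rw [← Set.ncard_eq_toFinset_card _ (Set.toFinite _)]
    refine harc.ncard_conicPoints_le (by omega) ?_ hS.2
    rw [← hTK]
    exact_mod_cast hS.1
  rw [← Set.ncard_coe_finset, hTK] at hcover
  have hplane := Projectivization.card_of_finrank F (Fin 3 → F) (n := 3) (by simp)
  rw [← Set.ncard_add_ncard_compl K] at hplane
  simp only [Finset.sum_range_succ, Finset.sum_range_zero, pow_zero, pow_one, Nat.card_eq_fintype_card] at hplane
  omega
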